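/- Let G be a finite group with a cyclic p-Sylow subgroup P of order p^n. Then either G is p-solvable, or G has a simple composition factor S whose order is divisible by p^n. -/

import Mathlib

/-- A finite group is `p`-solvable if every simple composition factor (equivalently, every
simple subquotient) of order divisible by `p` is isomorphic to `Z/p`. -/
def IsPSolvable (p : ℕ) (G : Type*) [Group G] : Prop :=
  ∀ (H : Subgroup G) (K : Subgroup H) (hK : K.Normal),
    (haveI := hK; IsSimpleGroup (H ⧸ K)) → p ∣ Nat.card (H ⧸ K) →
      (haveI := hK; Nonempty ((H ⧸ K) ≃* Multiplicative (ZMod p)))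

universe u

/-- There is a simple subquotient of order divisible by `m`. -/
def HasBig (m : ℕ) (G : Type u) [Group G] : Prop :=
  ∃ (H : Subgroup G) (K : Subgroup H) (hK : K.Normal),
        (haveI := hK; IsSimpleGroup (H ⧸ K)) ∧ m ∣ Nat.card (H ⧸ K)

/-- All `p`-subgroups are cyclic. -/
def CycHyp (p : ℕ) (G : Type u) [Group G] : Prop :=
  ∀ Q : Subgroup G, IsPGroup p Q → IsCyclic Q

theorem psolv_elim {p : ℕ} {G : Type u} [Group G] (h : IsPSolvable p G) (H : Subgroup G)
    {S : Type u} [Group S] [IsSimpleGroup S] (f : H →* S) (hf : Function.Surjective f)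
    (hp : p ∣ Nat.card S) : Nonempty (S ≃* Multiplicative (ZMod p)) := by
  have e := QuotientGroup.quotientKerEquivOfSurjective f hf
  obtain ⟨e2⟩ := h H f.ker inferInstance (e.isSimpleGroup) (by rwa [Nat.card_congr e.toEquiv])
  exact ⟨e.symm.trans e2⟩

theorem hasBig_of {m : ℕ} {G : Type u} [Group G] (H : Subgroup G)
    {S : Type u} [Group S] [IsSimpleGroup S] (f : H →* S) (hf : Function.Surjective f)
    (hp : m ∣ Nat.card S) : HasBig m G := by
  have e := QuotientGroup.quotientKerEquivOfSurjective f hf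
  exact ⟨H, f.ker, inferInstance, e.isSimpleGroup, by rwa [Nat.card_congr e.toEquiv]⟩

theorem psolv_ext {p : ℕ} {G : Type u} [Group G] (N : Subgroup G) [N.Normal]
    (h1 : IsPSolvable p N) (h2 : IsPSolvable p (G ⧸ N)) : IsPSolvable p G := by
  intro H K hK hs hp
  have hs : IsSimpleGroup (H ⧸ K) := hs
  set f := QuotientGroup.mk' K with hf
  have hfs : Function.Surjective f := QuotientGroup.mk'_surjective K
  have hn : ((N.subgroupOf H).map f).Normal := Subgroup.Normal.map inferInstance f hfs
  rcases hn.eq_bot_or_eq_top with h | h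
  · -- factor of the quotient
    let g := (QuotientGroup.mk' N).subgroupMap H
    have hg : Function.Surjective g := (QuotientGroup.mk' N).subgroupMap_surjective H
    have hk : g.ker ≤ f.ker := by
      intro x hx
      have hx' : (x : G) ∈ N := by
        have := congrArg Subtype.val (MonoidHom.mem_ker.1 hx)
        exact (QuotientGroup.eq_one_iff (N := N) (x : G)).1 this
      have : f x ∈ (N.subgroupOf H).map f := ⟨x, hx', rfl⟩
      rw [h] at this
      exact this
    let l := g.liftOfSurjective hg ⟨f, hk⟩
    refine psolv_elim h2 _ l ?_ hp
    intro s
    obtain ⟨x, rfl⟩ := hfs s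
    refine ⟨g x, ?_⟩
    exact MonoidHom.liftOfRightInverse_comp_apply g _ (Function.rightInverse_surjInv hg) ⟨f, hk⟩ x
  · let i : (H.subgroupOf N) →* H :=
      { toFun := fun x => ⟨((x : N) : G), x.2⟩
        map_one' := rfl
        map_mul' := fun _ _ => rfl }
    refine psolv_elim h1 _ (f.comp i) ?_ hp
    intro s
    have : s ∈ (N.subgroupOf H).map f := by rw [h]; trivial
    obtain ⟨x, hx, rfl⟩ := this
    exact ⟨⟨⟨x, hx⟩, x.2⟩, rfl⟩

theorem hasBig_sub {m : ℕ} {G : Type u} [Group G] (N : Subgroup G) (h : HasBig m N) :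
    HasBig m G := by
  obtain ⟨H, K, hK, hs, hm⟩ := h
  have hs : IsSimpleGroup (H ⧸ K) := hs
  let e := H.equivMapOfInjective N.subtype N.subtype_injective
  exact hasBig_of (H.map N.subtype) ((QuotientGroup.mk' K).comp e.symm.toMonoidHom)
    ((QuotientGroup.mk'_surjective K).comp e.symm.surjective) hm

theorem hasBig_quot {m : ℕ} {G : Type u} [Group G] (N : Subgroup G) [N.Normal]
    (h : HasBig m (G ⧸ N)) : HasBig m G := by
  obtain ⟨H, K, hK, hs, hm⟩ := h
  have hs : IsSimpleGroup (H ⧸ K) := hs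
  exact hasBig_of (H.comap (QuotientGroup.mk' N))
    ((QuotientGroup.mk' K).comp ((QuotientGroup.mk' N).subgroupComap H))
    ((QuotientGroup.mk'_surjective K).comp
      ((QuotientGroup.mk' N).subgroupComap_surjective_of_surjective H
        (QuotientGroup.mk'_surjective N))) hm

theorem psolv_of_not_dvd {p : ℕ} {G : Type u} [Group G] (h : ¬ p ∣ Nat.card G) :
    IsPSolvable p G := by
  intro H K hK hs hp
  exact absurd ((hp.trans (Subgroup.card_quotient_dvd_card K)).trans
    (Subgroup.card_subgroup_dvd_card H)) h

theorem psolv_of_comm {p : ℕ} (hp : p.Prime) {G : Type u} [Group G]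
    (h : ∀ a b : G, a * b = b * a) : IsPSolvable p G := by
  intro H K hK hs hd
  have hs : IsSimpleGroup (H ⧸ K) := hs
  have hc : IsMulCommutative (H ⧸ K) := by
    refine ⟨⟨fun a b => ?_⟩⟩
    obtain ⟨a, rfl⟩ := QuotientGroup.mk'_surjective K a
    obtain ⟨b, rfl⟩ := QuotientGroup.mk'_surjective K b
    rw [← map_mul, ← map_mul]
    congr 1
    exact Subtype.ext (h _ _)
  have h1 : (Nat.card (H ⧸ K)).Prime := Group.is_simple_iff_prime_card.1 hs
  have h2 := (Nat.prime_dvd_prime_iff_eq hp h1).1 hd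
  have := Fact.mk hp
  exact ⟨mulEquivOfPrimeCardEq (p := p) h2.symm (by simp)⟩

theorem psolv_of_commutator {p : ℕ} (hp : p.Prime) {G : Type u} [Group G]
    (h : ¬ p ∣ Nat.card (commutator G)) : IsPSolvable p G :=
  psolv_ext (commutator G) (psolv_of_not_dvd h)
    (psolv_of_comm hp (fun a b => @mul_comm (Abelianization G) _ a b))

theorem cyc_sub {p : ℕ} {G : Type u} [Group G] (N : Subgroup G) (h : CycHyp p G) :
    CycHyp p N := by
  intro Q hQ
  let e := Q.equivMapOfInjective N.subtype N.subtype_injective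
  have := h (Q.map N.subtype) (hQ.map _)
  exact isCyclic_of_surjective e.symm e.symm.surjective

theorem cyc_of_sylow {p : ℕ} {G : Type u} [Group G] (h : ∀ P : Sylow p G, IsCyclic P) :
    CycHyp p G := by
  intro Q hQ
  obtain ⟨P, hP⟩ := hQ.exists_le_sylow
  have := h P
  exact isCyclic_of_injective (Subgroup.inclusion hP) (Subgroup.inclusion_injective hP)

theorem cyc_quot {p : ℕ} (hp : p.Prime) {G : Type u} [Group G] [Finite G] (N : Subgroup G)
    [N.Normal] (h : CycHyp p G) : CycHyp p (G ⧸ N) := by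
  have := Fact.mk hp
  apply cyc_of_sylow
  intro P
  obtain ⟨P', rfl⟩ := Sylow.mapSurjective_surjective (QuotientGroup.mk'_surjective N) p P
  have := h P' P'.isPGroup'
  exact isCyclic_of_surjective ((QuotientGroup.mk' N).subgroupMap (P' : Subgroup G))
    ((QuotientGroup.mk' N).subgroupMap_surjective _)

theorem dichotomy {p : ℕ} (hp : p.Prime) {G : Type u} [Group G] [Finite G] (h : CycHyp p G) :
    ¬ p ∣ Nat.card (commutator G) ∨ ¬ p ∣ (commutator G).index := by
  have := Fact.mk hp
  let P : Sylow p G := default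
  have : IsCyclic P := h P P.isPGroup'
  exact Sylow.not_dvd_card_commutator_or_not_dvd_index_commutator P

/-- A normal subgroup with `p` dividing its order and index has commutator of order prime to `p`. -/
theorem normal_commutator {p : ℕ} (hp : p.Prime) {G : Type u} [Group G] [Finite G]
    (h : CycHyp p G) (N : Subgroup G) [N.Normal] (hi : p ∣ N.index) :
    ¬ p ∣ Nat.card (commutator N) := by
  have := Fact.mk hp
  let P : Sylow p G := default
  have hPc : IsCyclic P := h P P.isPGroup'
  let L : Subgroup G := N ⊔ P
  have hcomm : commutator L ≤ N.subgroupOf L := by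
    rw [commutator_def, Subgroup.commutator_le]
    intro a _ b _
    have key : ∀ x : L, ∃ y ∈ (P : Subgroup G), QuotientGroup.mk' N (x : G) = QuotientGroup.mk' N y := by
      intro x
      obtain ⟨n, hn, y, hy, hxy⟩ := Subgroup.mem_sup_of_normal_left.1 x.2
      refine ⟨y, hy, ?_⟩
      rw [← hxy, map_mul, (QuotientGroup.eq_one_iff (N := N) n).2 hn |> (fun e => (e : QuotientGroup.mk' N n = 1)), one_mul]
    obtain ⟨y, hy, hay⟩ := key a
    obtain ⟨z, hz, hbz⟩ := key b
    have hyz : y * z = z * y :=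
      congrArg Subtype.val (IsCyclic.isMulCommutative.is_comm.comm (⟨y, hy⟩ : (P : Subgroup G)) ⟨z, hz⟩)
    rw [Subgroup.mem_subgroupOf]
    refine (QuotientGroup.eq_one_iff (N := N) _).1 ?_
    change QuotientGroup.mk' N ((a : G) * b * (a : G)⁻¹ * (b : G)⁻¹) = 1
    rw [map_mul, map_mul, map_mul, map_inv, map_inv, hay, hbz, ← map_mul, hyz, map_mul]
    group
  rcases dichotomy hp (cyc_sub L h) with h1 | h1
  · intro h2
    apply h1
    refine h2.trans ?_
    let i : N →* L := Subgroup.inclusion (le_sup_left : N ≤ L)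
    have hi : Function.Injective i := Subgroup.inclusion_injective _
    have e : (commutator N).map i ≤ commutator L := by
      rw [commutator_def, commutator_def, Subgroup.map_commutator]
      exact Subgroup.commutator_mono le_top le_top
    rw [Nat.card_congr ((commutator N).equivMapOfInjective i hi).toEquiv]
    exact Subgroup.card_dvd_of_le e
  · exfalso
    have h2 : N.relIndex L ∣ (commutator L).index := Subgroup.index_dvd_of_le hcomm
    have h3 : L.index ∣ (P : Subgroup G).index := Subgroup.index_dvd_of_le le_sup_right
    rw [← Subgroup.relIndex_mul_index (le_sup_left : N ≤ L)] at hi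
    rcases hp.dvd_mul.1 hi with h4 | h4
    · exact h1 (h4.trans h2)
    · exact P.not_dvd_index (h4.trans h3)

theorem perfect_central {p : ℕ} (hp : p.Prime) {G : Type u} [Group G] [Finite G]
    (h : CycHyp p G) (hG : commutator G = ⊤) (g : G) (hg : ∀ x, x * g = g * x)
    (k : ℕ) (hk : g ^ p ^ k = 1) : g = 1 := by
  have := Fact.mk hp
  let P : Sylow p G := default
  have hPc : IsCyclic P := h P P.isPGroup'
  let _ : CommGroup P := IsCyclic.commGroup
  let t : G →* P := MonoidHom.transfer (MonoidHom.id P)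
  have h1 : t g = 1 := by
    have : g ∈ t.ker := Abelianization.commutator_subset_ker t (by rw [hG]; trivial)
    exact this
  have hkey : ∀ (k : ℕ) (g₀ : G), g₀⁻¹ * g ^ k * g₀ ∈ (P : Subgroup G) →
      g₀⁻¹ * g ^ k * g₀ = g ^ k := by
    intro k g₀ _
    have : Commute g₀ g := hg g₀
    rw [mul_assoc, ← (this.pow_right k).eq, inv_mul_cancel_left]
  have h2 := MonoidHom.transfer_eq_pow (MonoidHom.id P) g hkey
  have h3 : g ^ (P : Subgroup G).index = 1 := congrArg Subtype.val (h2.symm.trans h1)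
  have h4 : Nat.Coprime (p ^ k) (P : Subgroup G).index :=
    Nat.Coprime.pow_left _ ((Nat.Prime.coprime_iff_not_dvd hp).2 P.not_dvd_index)
  have := Nat.dvd_gcd (orderOf_dvd_of_pow_eq_one hk) (orderOf_dvd_of_pow_eq_one h3)
  rw [h4] at this
  exact orderOf_eq_one_iff.1 (Nat.dvd_one.1 this)

theorem main_aux {p : ℕ} (hp : p.Prime) : ∀ (m : ℕ) (G : Type u) [Group G] [Finite G],
    Nat.card G = m → CycHyp p G →
    IsPSolvable p G ∨ HasBig (p ^ (Nat.card G).factorization p) G := by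
  have := Fact.mk hp
  intro m
  induction m using Nat.strong_induction_on with
  | _ m ih =>
  intro G _ _ hm hc
  by_cases hpd : p ∣ Nat.card G
  swap
  · exact Or.inl (psolv_of_not_dvd hpd)
  by_contra hcon
  -- no proper normal subgroup of index prime to p
  have caseA : ∀ N : Subgroup G, N.Normal → ¬ p ∣ N.index → N = ⊤ := by
    intro N hN hi
    by_contra hne
    have hlt : Nat.card N < m := by
      rw [← hm]
      exact lt_of_le_of_ne (Nat.le_of_dvd Nat.card_pos (Subgroup.card_subgroup_dvd_card N))
        (fun e => hne (Subgroup.eq_top_of_card_eq N e))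
    have hf : (Nat.card G).factorization p = (Nat.card N).factorization p := by
      rw [← N.card_mul_index, Nat.factorization_mul Nat.card_pos.ne' Subgroup.FiniteIndex.index_ne_zero,
        Finsupp.add_apply, Nat.factorization_eq_zero_of_not_dvd hi, add_zero]
    apply hcon
    rw [hf]
    rcases ih _ hlt N rfl (cyc_sub N hc) with h | h
    · exact Or.inl (psolv_ext N h (psolv_of_not_dvd hi))
    · exact Or.inr (hasBig_sub N h)
  have caseB : ∀ N : Subgroup G, N.Normal → ¬ p ∣ Nat.card N → N = ⊥ := by
    intro N hN hi
    by_contra hne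
    have hlt : Nat.card (G ⧸ N) < m := by
      rw [← hm, ← N.card_mul_index]
      have h1 : Nat.card N ≠ 1 := fun e => hne (Subgroup.eq_bot_of_card_eq N e)
      have h2 : 0 < Nat.card N := Nat.card_pos
      have h3 : 0 < N.index := Nat.pos_of_ne_zero Subgroup.FiniteIndex.index_ne_zero
      change N.index < _
      nlinarith [show 2 ≤ Nat.card N by omega]
    have hf : (Nat.card G).factorization p = (Nat.card (G ⧸ N)).factorization p := by
      rw [← N.card_mul_index, Nat.factorization_mul Nat.card_pos.ne' Subgroup.FiniteIndex.index_ne_zero,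
        Finsupp.add_apply, Nat.factorization_eq_zero_of_not_dvd hi, zero_add]
      rfl
    apply hcon
    rw [hf]
    rcases ih _ hlt (G ⧸ N) rfl (cyc_quot hp N hc) with h | h
    · exact Or.inl (psolv_ext N (psolv_of_not_dvd hi) h)
    · exact Or.inr (hasBig_quot N h)
  -- G perfect
  have hperf : commutator G = ⊤ := by
    rcases dichotomy hp hc with h | h
    · exact absurd (Or.inl (psolv_of_commutator hp h)) hcon
    · exact caseA _ inferInstance h
  have hnt : Nontrivial G := by
    rw [← Finite.one_lt_card_iff_nontrivial]
    exact lt_of_lt_of_le hp.one_lt (Nat.le_of_dvd Nat.card_pos hpd)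
  by_cases hsimple : IsSimpleGroup G
  · apply hcon
    right
    exact hasBig_of ⊤ (Subgroup.topEquiv (G := G)).toMonoidHom
      (Subgroup.topEquiv (G := G)).surjective (Nat.ordProj_dvd _ _)
  have : ∃ N : Subgroup G, N.Normal ∧ N ≠ ⊥ ∧ N ≠ ⊤ := by
    by_contra hno
    push Not at hno
    exact hsimple ⟨fun N hN => or_iff_not_imp_left.2 (hno N hN)⟩
  obtain ⟨N, hN, hb, ht⟩ := this
  have hd1 : p ∣ N.index := by
    by_contra h
    exact ht (caseA N hN h)
  have hd2 : p ∣ Nat.card N := by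
    by_contra h
    exact hb (caseB N hN h)
  have hNc := normal_commutator hp hc N hd1
  have hN0 : (commutator N).map N.subtype = ⊥ := by
    apply caseB _ inferInstance
    rwa [← Nat.card_congr ((commutator N).equivMapOfInjective N.subtype N.subtype_injective).toEquiv]
  have hN1 : commutator N = ⊥ := (Subgroup.map_eq_bot_iff_of_injective _ N.subtype_injective).1 hN0
  have hNcomm : ∀ a b : N, a * b = b * a := by
    intro a b
    have : a * b * a⁻¹ * b⁻¹ ∈ commutator N :=
      Subgroup.commutator_mem_commutator (Subgroup.mem_top a) (Subgroup.mem_top b)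
    rw [hN1] at this
    have h1 : a * b * a⁻¹ * b⁻¹ = 1 := this
    rwa [mul_inv_eq_one, mul_inv_eq_iff_eq_mul] at h1
  let Q : Sylow p N := default
  have hQn : (Q : Subgroup N).Normal := ⟨fun n hn g => by
    rw [hNcomm g n, mul_inv_cancel_right]; exact hn⟩
  have hQchar : (Q : Subgroup N).Characteristic := Q.characteristic_of_normal hQn
  let R : Subgroup G := (Q : Subgroup N).map N.subtype
  have hR : R.Normal := inferInstance
  have hRp : IsPGroup p R := Q.isPGroup'.map _
  obtain ⟨P, hRP⟩ := hRp.exists_le_sylow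
  have hPc : IsCyclic P := hc P P.isPGroup'
  have hPC : (P : Subgroup G) ≤ Subgroup.centralizer (R : Set G) := by
    intro y hy
    rw [Subgroup.mem_centralizer_iff]
    intro z hz
    exact congrArg Subtype.val
      (IsCyclic.isMulCommutative.is_comm.comm (⟨z, hRP hz⟩ : (P : Subgroup G)) ⟨y, hy⟩)
  have hCt : Subgroup.centralizer (R : Set G) = ⊤ :=
    caseA _ inferInstance (fun h => P.not_dvd_index (h.trans (Subgroup.index_dvd_of_le hPC)))
  have hRbot : R = ⊥ := by
    rw [eq_bot_iff]
    intro g hg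
    obtain ⟨k, hk⟩ := hRp ⟨g, hg⟩
    refine perfect_central hp hc hperf g (fun x => ?_) k (congrArg Subtype.val hk)
    have hx : x ∈ Subgroup.centralizer (R : Set G) := by rw [hCt]; trivial
    exact (Subgroup.mem_centralizer_iff.1 hx g hg).symm
  have hQbot : (Q : Subgroup N) = ⊥ :=
    (Subgroup.map_eq_bot_iff_of_injective _ N.subtype_injective).1 hRbot
  exact Q.ne_bot_of_dvd_card hd2 hQbot

/-- A finite group with a cyclic `p`-Sylow subgroup of order `p^n` is either `p`-solvable or
has a simple composition factor of order divisible by `p^n`. -/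
theorem psolvable_or_simple_factor (p n : ℕ) (hp : p.Prime)
    (G : Type*) [Group G] [Finite G]
    (P : Sylow p G) (hcyc : IsCyclic ↥(P : Subgroup G))
    (hcard : Nat.card ↥(P : Subgroup G) = p ^ n) :
    IsPSolvable p G ∨
      ∃ (H : Subgroup G) (K : Subgroup H) (hK : K.Normal),
        (haveI := hK; IsSimpleGroup (H ⧸ K)) ∧ p ^ n ∣ Nat.card (H ⧸ K) := by
  have := Fact.mk hp
  have hc : CycHyp p G := by
    apply cyc_of_sylow
    intro P'
    have e := P.equiv P'
    exact isCyclic_of_surjective e e.surjective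
  have hn : Nat.card ↥(P : Subgroup G) = p ^ (Nat.card G).factorization p :=
    P.card_eq_multiplicity
  rw [← hcard, hn]
  exact main_aux hp _ G rfl hc
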